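/- Let Γ be a discrete, torsion-free subgroup of SL(2,ℝ) not containing −1, let u ∈ SL(2,ℝ), and suppose there is a sequence (γ_n)_{n≥0} of hyperbolic elements of Γ such that for every n the axis Axis(γ_n) meets the geodesic ray {u • (eᵗ i) : t ≥ 0}, and ℓ(γ_n) → 0. Then there exists w ∈ SL(2,ℝ) such that (a) lim_{t→+∞} ⨅_{γ ∈ Γ} d₁( u * A(t), γ * (w * A(t)) ) = 0 (i.e. w lies in the strong stable set W^{ss}(u) of the quotient Γ\PSL(2,ℝ)), and (b) for all γ ∈ Γ, all s ∈ ℝ and all ε ∈ {1, −1}, w ≠ ε • (γ * u * N(s)) (i.e. w does not lie on the horocyclic orbit of u in the quotient). In particular h_ℝ u ⊊ W^{ss}(u). -/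

import Mathlib

open UpperHalfPlane Matrix Real Filter Topology
open scoped MatrixGroups

noncomputable section

namespace BellisFormal

/-- The point `eᵗ i` of the upper half-plane. -/
def vray (t : ℝ) : ℍ := ⟨⟨0, Real.exp t⟩, Real.exp_pos t⟩

/-- Translation length of `γ`. -/
def transLength (γ : SL(2, ℝ)) : ℝ := ⨅ z : ℍ, dist z (γ • z)

/-- `γ` is hyperbolic: `|tr γ| > 2`. -/
def IsHyperbolic (γ : SL(2, ℝ)) : Prop :=
  2 < |Matrix.trace (γ : Matrix (Fin 2) (Fin 2) ℝ)|

/-- Axis of `γ`. -/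
def Axis (γ : SL(2, ℝ)) : Set ℍ := {z : ℍ | dist z (γ • z) = transLength γ}

/-- `x` is a real fixed point of the Möbius map of `γ`. -/
def IsFixedPt (γ : SL(2, ℝ)) (x : ℝ) : Prop :=
  γ 1 0 * x ^ 2 + (γ 1 1 - γ 0 0) * x - γ 0 1 = 0

def IsAttractingFixedPt (γ : SL(2, ℝ)) (x : ℝ) : Prop :=
  IsFixedPt γ x ∧ 1 < (γ 1 0 * x + γ 1 1) ^ 2

def IsRepellingFixedPt (γ : SL(2, ℝ)) (x : ℝ) : Prop :=
  IsFixedPt γ x ∧ (γ 1 0 * x + γ 1 1) ^ 2 < 1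

instance : TopologicalSpace SL(2, ℝ) :=
  TopologicalSpace.induced (fun g => (g : Matrix (Fin 2) (Fin 2) ℝ)) inferInstance

structure IsNestedSequence (γ : ℕ → SL(2, ℝ)) (γp γm : ℕ → ℝ) (t : ℕ → ℝ) : Prop where
  hyperbolic : ∀ n, IsHyperbolic (γ n)
  discrete : DiscreteTopology (Subgroup.closure (Set.range γ) : Subgroup SL(2, ℝ))
  attracting : ∀ n, IsAttractingFixedPt (γ n) (γp n)
  repelling : ∀ n, IsRepellingFixedPt (γ n) (γm n)
  plus_pos : ∀ n, 0 < γp n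
  plus_mono : StrictMono γp
  minus_neg : ∀ n, γm n < 0
  minus_anti : StrictAnti γm
  t_pos : ∀ n, 0 < t n
  axis_meets : ∀ n, ∀ s : ℝ, 0 ≤ s → (vray s ∈ Axis (γ n) ↔ s = t n)
  len_anti : StrictAnti fun n => transLength (γ n)
  len_tendsto : Filter.Tendsto (fun n => transLength (γ n)) Filter.atTop (nhds 0)

/-- geodesic flow matrix -/
def A (t : ℝ) : SL(2, ℝ) :=
  ⟨!![Real.exp (t / 2), 0; 0, Real.exp (-(t / 2))], by
    simp [Matrix.det_fin_two_of, ← Real.exp_add]⟩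

/-- horocyclic flow matrix -/
def N (s : ℝ) : SL(2, ℝ) :=
  ⟨!![1, s; 0, 1], by simp [Matrix.det_fin_two_of]⟩

/-- the distance `d₁` between unit tangent vectors encoded as elements of `SL(2,ℝ)` -/
def d1 (g h : SL(2, ℝ)) : ℝ :=
  dist (g • vray 0) (h • vray 0) + dist (g • vray 1) (h • vray 1)

/-- product `α 0 * α 1 * ⋯ * α n` -/
def seqProd (α : ℕ → SL(2, ℝ)) (n : ℕ) : SL(2, ℝ) :=
  ((List.range (n + 1)).map α).prod


/-- the point `a + y i` of the upper half-plane -/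
def mkPt (a y : ℝ) (hy : 0 < y) : ℍ := ⟨⟨a, y⟩, hy⟩

/-- the Busemann cocycle values `r_n = B_∞(β_n⁻¹ • i, i)` -/
def busR (α : ℕ → SL(2, ℝ)) (n : ℕ) : ℝ :=
  - Real.log (((seqProd α n)⁻¹ • UpperHalfPlane.I).im)



/-- `g` is close to the identity after conjugation by the geodesic flow at height `E`. -/
structure Near (η E : ℝ) (g : SL(2, ℝ)) : Prop where
  h00 : |g 0 0 - 1| ≤ η
  h01 : |g 0 1| ≤ η * E
  h10 : |g 1 0| * E ≤ η
  h11 : |g 1 1 - 1| ≤ η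

theorem sl_mul (g h : SL(2, ℝ)) (i j : Fin 2) :
    (g * h) i j = g i 0 * h 0 j + g i 1 * h 1 j := by
  simp [Matrix.SpecialLinearGroup.coe_mul, Matrix.mul_apply, Fin.sum_univ_two]

theorem sl_det (g : SL(2, ℝ)) : g 0 0 * g 1 1 - g 0 1 * g 1 0 = 1 := by
  have := g.det_coe
  rwa [Matrix.det_fin_two] at this

theorem near_one {η E : ℝ} (hη : 0 ≤ η) (hE : 0 < E) : Near η E 1 := by
  constructor <;> simp <;> positivity

theorem near_apply {η E : ℝ} {g : SL(2, ℝ)} (hg : Near η E g) (hη : 0 ≤ η) (hE : 0 < E)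
    {x z B : ℝ} (hx : |x| ≤ B) (hz : |z| * E ≤ B) :
    |g 0 0 * x + g 0 1 * z| ≤ (1 + 2 * η) * B ∧
    |g 1 0 * x + g 1 1 * z| * E ≤ (1 + 2 * η) * B := by
  have hB : 0 ≤ B := (abs_nonneg x).trans hx
  have h0 : |g 0 0| ≤ 1 + η := by
    have := abs_add_le (g 0 0 - 1) 1
    simp at this; linarith [hg.h00]
  have h1 : |g 1 1| ≤ 1 + η := by
    have := abs_add_le (g 1 1 - 1) 1
    simp at this; linarith [hg.h11]
  constructor
  · calc |g 0 0 * x + g 0 1 * z| ≤ |g 0 0| * |x| + |g 0 1| * |z| := by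
          rw [← abs_mul, ← abs_mul]; exact abs_add_le _ _
      _ ≤ (1 + η) * B + (η * E) * |z| := by
          gcongr; exact hg.h01
      _ = (1 + η) * B + η * (|z| * E) := by ring
      _ ≤ (1 + η) * B + η * B := by gcongr
      _ = _ := by ring
  · calc |g 1 0 * x + g 1 1 * z| * E ≤ (|g 1 0| * |x| + |g 1 1| * |z|) * E := by
          rw [← abs_mul, ← abs_mul]; gcongr; exact abs_add_le _ _
      _ = (|g 1 0| * E) * |x| + |g 1 1| * (|z| * E) := by ring
      _ ≤ η * B + (1 + η) * B := by
          gcongr; exact hg.h10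
      _ = _ := by ring

structure Good (α : ℕ → SL(2, ℝ)) (η E : ℕ → ℝ) : Prop where
  pos : ∀ n, 0 < η n
  small : ∀ n, η n ≤ 1 / 100
  dec : ∀ n, 4 * η (n + 1) ≤ η n
  Epos : ∀ n, 0 < E n
  Einc : ∀ n, E n ≤ η (n + 1) * E (n + 1)
  near : ∀ n, Near (η n) (E n) (α n)

theorem Good.Emono {α : ℕ → SL(2, ℝ)} {η E : ℕ → ℝ} (h : Good α η E) (n : ℕ) :
    E n ≤ E (n + 1) := by
  have := h.Einc n
  nlinarith [h.small (n + 1), h.Epos (n + 1), h.pos (n + 1)]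

def tp (α : ℕ → SL(2, ℝ)) : ℕ → ℕ → SL(2, ℝ)
  | _, 0 => 1
  | n, N + 1 => α n * tp α (n + 1) N

theorem tp_succ (α : ℕ → SL(2, ℝ)) (N n : ℕ) : tp α n (N + 1) = tp α n N * α (n + N) := by
  induction N generalizing n with
  | zero => simp [tp]
  | succ N ih =>
    rw [tp, ih, ← mul_assoc, show n + 1 + N = n + (N + 1) by ring]
    rfl

theorem tp_bound {α : ℕ → SL(2, ℝ)} {η E : ℕ → ℝ} (h : Good α η E) (N n : ℕ)
    {x z B : ℝ} (hx : |x| ≤ B) (hz : |z| * E (n + N) ≤ B) :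
    |tp α n N 0 0 * x + tp α n N 0 1 * z| ≤ (1 + 4 * η n) * B ∧
    |tp α n N 1 0 * x + tp α n N 1 1 * z| * E n ≤ (1 + 4 * η n) * B := by
  have hB : 0 ≤ B := (abs_nonneg x).trans hx
  induction N generalizing n with
  | zero =>
    have := h.pos n
    have : 0 ≤ η n * B := by positivity
    simp [tp] at hz ⊢
    constructor <;> nlinarith
  | succ N ih =>
    obtain ⟨h1, h2⟩ := ih (n + 1) (by rwa [show n + 1 + N = n + (N + 1) by ring])
    have h3 : |tp α (n + 1) N 1 0 * x + tp α (n + 1) N 1 1 * z| * E n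
        ≤ (1 + 4 * η (n + 1)) * B := by
      refine le_trans ?_ h2
      gcongr
      exact h.Emono n
    obtain ⟨h4, h5⟩ := near_apply (h.near n) (h.pos n).le (h.Epos n) h1 h3
    have key : (1 + 2 * η n) * ((1 + 4 * η (n + 1)) * B) ≤ (1 + 4 * η n) * B := by
      rw [← mul_assoc]
      gcongr
      nlinarith [h.pos n, h.small n, h.dec n, h.pos (n + 1)]
    constructor
    · refine le_trans (le_of_eq ?_) (h4.trans key)
      rw [tp, sl_mul, sl_mul]; congr 1; ring
    · refine le_trans (le_of_eq ?_) (h5.trans key)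
      rw [tp, sl_mul, sl_mul]; congr 2; ring

theorem tp_near {α : ℕ → SL(2, ℝ)} {η E : ℕ → ℝ} (h : Good α η E) (N n : ℕ) :
    |tp α n N 0 0 - 1| ≤ 3 * η n ∧ |tp α n N 1 0| * E n ≤ 3 * η n := by
  induction N generalizing n with
  | zero =>
    have := h.pos n
    simp [tp]; linarith
  | succ N ih =>
    obtain ⟨h1, h2⟩ := ih (n + 1)
    have h3 : |tp α (n + 1) N 1 0| * E n ≤ 3 * η (n + 1) := by
      refine le_trans ?_ h2
      gcongr
      exact h.Emono n
    obtain ⟨h4, h5⟩ := near_apply (h.near n) (h.pos n).le (h.Epos n) h1 h3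
    have key : (1 + 2 * η n) * (3 * η (n + 1)) + η n ≤ 3 * η n := by
      nlinarith [h.pos n, h.small n, h.dec n, h.pos (n + 1)]
    have := h.near n
    rw [tp, sl_mul, sl_mul]
    constructor
    · refine le_trans ?_ (le_trans (add_le_add h4 this.h00) key)
      refine le_trans (le_of_eq ?_) (abs_add_le _ _)
      congr 1; ring
    · refine le_trans ?_ (le_trans (add_le_add h5 this.h10) key)
      rw [← add_mul]
      have := h.Epos n
      gcongr
      refine le_trans (le_of_eq ?_) (abs_add_le _ _)
      congr 1; ring

theorem Good.geom {α : ℕ → SL(2, ℝ)} {η E : ℕ → ℝ} (h : Good α η E) (n N : ℕ) :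
    η (n + N) ≤ η n * (1 / 4) ^ N := by
  induction N with
  | zero => simp
  | succ N ih =>
    have := h.dec (n + N)
    rw [pow_succ, ← add_assoc]; linarith

theorem tp_step {α : ℕ → SL(2, ℝ)} {η E : ℕ → ℝ} (h : Good α η E) (N n : ℕ) :
    |tp α n N 0 0 - tp α n (N + 1) 0 0| ≤ 2 * η n * (1 / 4) ^ N ∧
    |tp α n N 1 0 - tp α n (N + 1) 1 0| ≤ 2 * η n / E n * (1 / 4) ^ N := by
  have hn := h.near (n + N)
  obtain ⟨h1, h2⟩ := tp_bound h N n hn.h00 hn.h10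
  have key : (1 + 4 * η n) * η (n + N) ≤ 2 * η n * (1 / 4) ^ N := by
    have := h.geom n N
    have h2 : (1 + 4 * η n) ≤ 2 := by linarith [h.small n]
    calc _ ≤ 2 * η (n + N) := by
            have := (h.pos (n + N)).le
            gcongr
      _ ≤ _ := by linarith
  have := h.Epos n
  rw [tp_succ, sl_mul, sl_mul]
  constructor
  · refine le_trans (le_of_eq ?_) (h1.trans key)
    rw [abs_sub_comm]; congr 1; ring
  · rw [div_mul_eq_mul_div, le_div_iff₀ this]
    refine le_trans (le_of_eq ?_) (h2.trans key)
    rw [abs_sub_comm]; congr 2; ring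

theorem exists_limit {α : ℕ → SL(2, ℝ)} {η E : ℕ → ℝ} (h : Good α η E) :
    ∃ X Z : ℕ → ℝ, ∀ n, |X n - 1| ≤ 3 * η n ∧ |Z n| * E n ≤ 3 * η n ∧
      X n = α n 0 0 * X (n + 1) + α n 0 1 * Z (n + 1) ∧
      Z n = α n 1 0 * X (n + 1) + α n 1 1 * Z (n + 1) := by
  have hX : ∀ n, ∃ x, Tendsto (fun N => tp α n N 0 0) atTop (𝓝 x) := fun n =>
    cauchySeq_tendsto_of_complete (cauchySeq_of_le_geometric (1 / 4) (2 * η n) (by norm_num)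
      (fun N => by rw [Real.dist_eq]; exact (tp_step h N n).1))
  have hZ : ∀ n, ∃ x, Tendsto (fun N => tp α n N 1 0) atTop (𝓝 x) := fun n =>
    cauchySeq_tendsto_of_complete (cauchySeq_of_le_geometric (1 / 4) (2 * η n / E n) (by norm_num)
      (fun N => by rw [Real.dist_eq]; exact (tp_step h N n).2))
  choose X hX using hX
  choose Z hZ using hZ
  refine ⟨X, Z, fun n => ⟨?_, ?_, ?_, ?_⟩⟩
  · exact le_of_tendsto ((hX n).sub_const 1).abs (.of_forall fun N => (tp_near h N n).1)
  · exact le_of_tendsto ((hZ n).abs.mul_const _) (.of_forall fun N => (tp_near h N n).2)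
  · refine tendsto_nhds_unique ((tendsto_add_atTop_iff_nat 1).2 (hX n)) ?_
    refine Tendsto.congr (fun N => ?_)
      (((hX (n + 1)).const_mul (α n 0 0)).add ((hZ (n + 1)).const_mul (α n 0 1)))
    rw [tp, sl_mul]
  · refine tendsto_nhds_unique ((tendsto_add_atTop_iff_nat 1).2 (hZ n)) ?_
    refine Tendsto.congr (fun N => ?_)
      (((hX (n + 1)).const_mul (α n 1 0)).add ((hZ (n + 1)).const_mul (α n 1 1)))
    rw [tp, sl_mul]

theorem sl_inv (g : SL(2, ℝ)) : g⁻¹ 0 0 = g 1 1 ∧ g⁻¹ 0 1 = - g 0 1 ∧ g⁻¹ 1 0 = - g 1 0 ∧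
    g⁻¹ 1 1 = g 0 0 := by
  simp [Matrix.SpecialLinearGroup.SL2_inv_expl]

theorem stable_estimate {α : ℕ → SL(2, ℝ)} {η E X Z : ℕ → ℝ} (h : Good α η E)
    (hXZ : ∀ n, |X n - 1| ≤ 3 * η n ∧ |Z n| * E n ≤ 3 * η n ∧
      X n = α n 0 0 * X (n + 1) + α n 0 1 * Z (n + 1) ∧
      Z n = α n 1 0 * X (n + 1) + α n 1 1 * Z (n + 1)) (w : SL(2, ℝ))
    (h00 : w 0 0 = X 0) (h10 : w 1 0 = Z 0) (h01 : w 0 1 = 0) (n : ℕ) (T : ℝ)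
    (hT1 : E n ≤ T) (hT2 : T ≤ E (n + 1)) :
    |((tp α 0 (n + 1))⁻¹ * w) 0 0 - 1| ≤ 12 * η n ∧
    |((tp α 0 (n + 1))⁻¹ * w) 0 1| ≤ 12 * η n * T ∧
    |((tp α 0 (n + 1))⁻¹ * w) 1 0| * T ≤ 12 * η n ∧
    |((tp α 0 (n + 1))⁻¹ * w) 1 1 - 1| ≤ 12 * η n := by
  obtain ⟨H, hH⟩ : ∃ H : ℕ → SL(2, ℝ), ∀ n, H n = (tp α 0 n)⁻¹ * w := ⟨_, fun _ => rfl⟩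
  have hrec : ∀ n, H (n + 1) = (α n)⁻¹ * H n := by
    intro n
    rw [hH, hH, tp_succ, zero_add, _root_.mul_inv_rev, mul_assoc]
  have hcol : ∀ n, H n 0 0 = X n ∧ H n 1 0 = Z n := by
    intro n
    induction n with
    | zero => simp [hH, tp, h00, h10]
    | succ n ih =>
      obtain ⟨i0, i1, i2, i3⟩ := sl_inv (α n)
      obtain ⟨-, -, e1, e2⟩ := hXZ n
      have hd := sl_det (α n)
      rw [hrec, sl_mul, sl_mul, i0, i1, i2, i3, ih.1, ih.2, e1, e2]
      constructor
      · linear_combination X (n + 1) * hd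
      · linear_combination Z (n + 1) * hd
  have hq : ∀ n, |H n 0 1| ≤ η n * E n → |H n 1 1 - 1| ≤ 12 * η n := by
    intro n hy
    obtain ⟨x1, z1, -, -⟩ := hXZ n
    have hd := sl_det (H n)
    rw [(hcol n).1, (hcol n).2] at hd
    have hE := h.Epos n
    have hη := h.pos n
    have hs := h.small n
    have hyz : |H n 0 1 * Z n| ≤ 3 * η n * η n := by
      rw [abs_mul]
      calc _ ≤ (η n * E n) * |Z n| := by gcongr
        _ = η n * (|Z n| * E n) := by ring
        _ ≤ η n * (3 * η n) := by gcongr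
        _ = _ := by ring
    have hx : 1 / 2 ≤ X n := by linarith [(abs_le.1 x1).1]
    have e : (H n 1 1 - 1) * X n = H n 0 1 * Z n - (X n - 1) := by linear_combination hd
    have : |H n 1 1 - 1| * X n ≤ 3 * η n * η n + 3 * η n := by
      have hXp : |H n 1 1 - 1| * X n = |(H n 1 1 - 1) * X n| := by
        rw [abs_mul, abs_of_pos (show 0 < X n by linarith)]
      rw [hXp, e]
      exact (abs_sub _ _).trans (add_le_add hyz x1)
    nlinarith [abs_nonneg (H n 1 1 - 1)]
  have hstep : ∀ n, |H n 0 1| ≤ η n * E n → |H (n + 1) 0 1| ≤ 4 * η n * E n := by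
    intro n hy
    obtain ⟨i0, i1, i2, i3⟩ := sl_inv (α n)
    have hn := h.near n
    have hE := h.Epos n
    have hη := h.pos n
    have hs := h.small n
    have q1 := hq n hy
    have q2 : |H n 1 1| ≤ 2 := by
      have := abs_add_le (H n 1 1 - 1) 1
      simp at this; linarith
    have q3 : |α n 1 1| ≤ 2 := by
      have := abs_add_le (α n 1 1 - 1) 1
      simp at this; linarith [hn.h11]
    rw [hrec, sl_mul, i0, i1]
    calc _ ≤ |α n 1 1| * |H n 0 1| + |α n 0 1| * |H n 1 1| := by
          rw [← abs_mul, ← abs_mul, neg_mul, ← sub_eq_add_neg]; exact abs_sub _ _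
      _ ≤ 2 * (η n * E n) + (η n * E n) * 2 := by
          gcongr; exact hn.h01
      _ = _ := by ring
  have hup : ∀ n, 4 * η n * E n ≤ η (n + 1) * E (n + 1) := by
    intro n
    have := h.Einc n
    have hE := h.Epos n
    have hη := h.pos n
    have hs := h.small n
    nlinarith
  have hy : ∀ n, |H n 0 1| ≤ η n * E n := by
    intro n
    induction n with
    | zero =>
      have hE := h.Epos 0
      have hη := h.pos 0
      simp [hH, tp, h01]; positivity
    | succ n ih => exact (hstep n ih).trans (hup n)
  rw [← hH]
  obtain ⟨x1, z1, -, -⟩ := hXZ (n + 1)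
  have hE := h.Epos n
  have hη := h.pos n
  have hd := h.dec n
  have hη' := h.pos (n + 1)
  refine ⟨?_, ?_, ?_, ?_⟩
  · rw [(hcol _).1]; linarith
  · refine (hstep n (hy n)).trans ?_
    nlinarith
  · rw [(hcol _).2]
    have : |Z (n + 1)| * T ≤ |Z (n + 1)| * E (n + 1) := by gcongr
    linarith
  · linarith [hq _ (hy (n + 1))]

theorem separation {η' E E' : ℝ} {g : SL(2, ℝ)} {η : ℝ} (hg : Near η E g) (hη : 0 < η)
    (hs : η ≤ 1 / 100) (hE : 0 < E) (hEE : E ≤ E') (hη' : 0 < η')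
    (hD : 13 * η' ≤ |g 0 0 - 1| ∨ 13 * η' ≤ |g 1 0| * E) {X Z X' Z' : ℝ}
    (hX : |X - 1| ≤ 3 * η') (hZ : |Z| * E' ≤ 3 * η')
    (hX' : |X' - 1| ≤ 3 * η') (hZ' : |Z'| * E' ≤ 3 * η')
    (e1 : g 0 0 * X + g 0 1 * Z = X') (e2 : g 1 0 * X + g 1 1 * Z = Z') : False := by
  have hZE : |Z| * E ≤ 3 * η' := le_trans (by gcongr) hZ
  have hZE' : |Z'| * E ≤ 3 * η' := le_trans (by gcongr) hZ'
  obtain ⟨h1, h2⟩ := near_apply hg hη.le hE hX hZE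
  have hb : (1 + 2 * η) * (3 * η') ≤ 6 * η' := by nlinarith
  rcases hD with hD | hD
  · have : g 0 0 - 1 = (X' - 1) - (g 0 0 * (X - 1) + g 0 1 * Z) := by rw [← e1]; ring
    have h3 := abs_sub (X' - 1) (g 0 0 * (X - 1) + g 0 1 * Z)
    rw [← this] at h3
    linarith
  · have : g 1 0 = Z' - (g 1 0 * (X - 1) + g 1 1 * Z) := by rw [← e2]; ring
    have h3 := abs_sub Z' (g 1 0 * (X - 1) + g 1 1 * Z)
    rw [← this] at h3
    have h4 : |g 1 0| * E ≤ (|Z'| + |g 1 0 * (X - 1) + g 1 1 * Z|) * E := by gcongr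
    linarith

theorem vray_eq (t : ℝ) : vray t = A t • vray 0 := by
  ext
  rw [coe_specialLinearGroup_apply]
  have h : (Complex.exp (t / 2)) ≠ 0 := Complex.exp_ne_zero _
  have e : ((⟨0, Real.exp t⟩ : ℂ)) = Complex.exp t * Complex.I := by
    apply Complex.ext <;> simp [← Complex.ofReal_exp]
  have e0 : ((⟨0, Real.exp 0⟩ : ℂ)) = Complex.I := by
    apply Complex.ext <;> simp
  change (⟨0, Real.exp t⟩ : ℂ) = _
  have e1 : ((vray 0 : ℍ) : ℂ) = Complex.I := e0
  rw [e1, e]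
  simp [A]
  rw [Complex.exp_neg, div_inv_eq_mul, mul_right_comm, ← Complex.exp_add]
  ring_nf

theorem cosh_algebra (a b c d : ℝ) (hd : a * d - b * c = 1) (hp : 0 < c ^ 2 + d ^ 2) :
    2 * (((0 - (a * c + b * d) / (c ^ 2 + d ^ 2)) ^ 2 + 1 ^ 2 + (1 / (c ^ 2 + d ^ 2)) ^ 2) /
      (2 * 1 * (1 / (c ^ 2 + d ^ 2)))) = a ^ 2 + b ^ 2 + c ^ 2 + d ^ 2 := by
  have h : c ^ 2 + d ^ 2 ≠ 0 := hp.ne'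
  field_simp
  linear_combination (-(1 + (a * d - b * c))) * hd

theorem re_algebra (a b c d : ℝ) (hp : 0 < c ^ 2 + d ^ 2) :
    (((a : ℂ) * Complex.I + b) / ((c : ℂ) * Complex.I + d)).re
      = (a * c + b * d) / (c ^ 2 + d ^ 2) := by
  have h : c * c + d * d ≠ 0 := by nlinarith
  have h' : d * d + c * c ≠ 0 := by nlinarith
  simp [Complex.div_re, Complex.normSq_apply]
  rw [← add_div]
  congr 1 <;> ring

theorem im_algebra (a b c d : ℝ) (hd : a * d - b * c = 1) :
    (((a : ℂ) * Complex.I + b) / ((c : ℂ) * Complex.I + d)).im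
      = 1 / (c ^ 2 + d ^ 2) := by
  simp [Complex.div_im, Complex.normSq_apply]
  rw [← sub_div, hd, one_div]
  congr 1; ring

theorem two_cosh_dist (k : SL(2, ℝ)) : 2 * Real.cosh (dist (vray 0) (k • vray 0)) =
    k 0 0 ^ 2 + k 0 1 ^ 2 + k 1 0 ^ 2 + k 1 1 ^ 2 := by
  have hd := sl_det k
  have e1 : ((vray 0 : ℍ) : ℂ) = Complex.I := by
    change (⟨0, Real.exp 0⟩ : ℂ) = _
    apply Complex.ext <;> simp
  have hpos : 0 < k 1 0 ^ 2 + k 1 1 ^ 2 := by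
    by_contra hc
    have h1 : k 1 0 = 0 := by nlinarith [sq_nonneg (k 1 0), sq_nonneg (k 1 1)]
    have h2 : k 1 1 = 0 := by nlinarith [sq_nonneg (k 1 0), sq_nonneg (k 1 1)]
    rw [h1, h2] at hd; simp at hd
  have hre0 : (vray 0).re = 0 := by rw [← coe_re, e1]; simp
  have him0 : (vray 0).im = 1 := by rw [← coe_im, e1]; simp
  have hre : (k • vray 0).re = (k 0 0 * k 1 0 + k 0 1 * k 1 1) / (k 1 0 ^ 2 + k 1 1 ^ 2) := by
    rw [← coe_re, coe_specialLinearGroup_apply, e1]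
    exact re_algebra _ _ _ _ hpos
  have him : (k • vray 0).im = 1 / (k 1 0 ^ 2 + k 1 1 ^ 2) := by
    rw [← coe_im, coe_specialLinearGroup_apply, e1]
    exact im_algebra _ _ _ _ hd
  rw [cosh_dist', hre0, him0, hre, him]
  exact cosh_algebra _ _ _ _ hd hpos

theorem A_entries (t : ℝ) : A t 0 0 = Real.exp (t / 2) ∧ A t 0 1 = 0 ∧ A t 1 0 = 0 ∧
    A t 1 1 = Real.exp (-(t / 2)) := by
  simp [A]

theorem conj_entries (g : SL(2, ℝ)) (t : ℝ) :
    ((A t)⁻¹ * g * A t) 0 0 = g 0 0 ∧ ((A t)⁻¹ * g * A t) 0 1 = g 0 1 * Real.exp (-t) ∧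
    ((A t)⁻¹ * g * A t) 1 0 = g 1 0 * Real.exp t ∧ ((A t)⁻¹ * g * A t) 1 1 = g 1 1 := by
  obtain ⟨a0, a1, a2, a3⟩ := A_entries t
  obtain ⟨i0, i1, i2, i3⟩ := sl_inv (A t)
  have e1 : Real.exp (t / 2) * Real.exp (-(t / 2)) = 1 := by rw [← Real.exp_add]; simp
  have e2 : Real.exp t = Real.exp (t / 2) * Real.exp (t / 2) := by
    rw [← Real.exp_add]; ring_nf
  have e3 : Real.exp (-t) = Real.exp (-(t / 2)) * Real.exp (-(t / 2)) := by
    rw [← Real.exp_add]; ring_nf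
  simp only [sl_mul, i0, i1, i2, i3, a0, a1, a2, a3, e2, e3]
  refine ⟨?_, by ring, by ring, ?_⟩
  · linear_combination g 0 0 * e1
  · linear_combination g 1 1 * e1

theorem real_bounds (a b c d s : ℝ) (h : a ^ 2 + b ^ 2 + c ^ 2 + d ^ 2 = s + 2)
    (hdet : a * d - b * c = 1) (htr : 4 < (a + d) ^ 2) :
    |2 * (b * c)| ≤ 2 * s ∧ |b * (a + d)| ≤ √s * √(s + 4) ∧ |c * (a + d)| ≤ √s * √(s + 4) ∧
    |(a - d) * a| ≤ √s * √(s + 4) ∧ |(a - d) * d| ≤ √s * √(s + 4) := by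
  have q1 : (a - d) ^ 2 + (b + c) ^ 2 = s := by linear_combination h - 2 * hdet
  have q2 : (a + d) ^ 2 + (b - c) ^ 2 = s + 4 := by linear_combination h + 2 * hdet
  have q3 : b ^ 2 + c ^ 2 ≤ s := by
    have : 2 * (b ^ 2 + c ^ 2) = (b + c) ^ 2 + (b - c) ^ 2 := by ring
    have := sq_nonneg (a - d)
    linarith
  have hA := sq_nonneg a
  have hB := sq_nonneg b
  have hC := sq_nonneg c
  have hD := sq_nonneg d
  have hBC := sq_nonneg (b - c)
  have hBC' := sq_nonneg (b + c)
  have aux : ∀ x y, x ^ 2 ≤ s → y ^ 2 ≤ s + 4 → |x * y| ≤ √s * √(s + 4) := by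
    intro x y hx hy
    rw [abs_mul]
    exact mul_le_mul (Real.abs_le_sqrt hx) (Real.abs_le_sqrt hy) (abs_nonneg _) (Real.sqrt_nonneg _)
  refine ⟨?_, aux _ _ ?_ ?_, aux _ _ ?_ ?_, aux _ _ ?_ ?_, aux _ _ ?_ ?_⟩ <;> try linarith
  rw [abs_le]; constructor <;> nlinarith

theorem near_of_dist (γ u : SL(2, ℝ)) (t l : ℝ) (hh : IsHyperbolic γ)
    (hl : dist (u • vray t) (γ • (u • vray t)) = l) :
    Near (2 * (2 * Real.cosh l - 2) + √(2 * Real.cosh l - 2) * √(2 * Real.cosh l - 2 + 4))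
      (Real.exp t) (u⁻¹ * γ ^ 2 * u) ∧
    ((u⁻¹ * γ ^ 2 * u) 0 0 ≠ 1 ∨ (u⁻¹ * γ ^ 2 * u) 1 0 ≠ 0) := by
  obtain ⟨f, hf⟩ : ∃ f, f = u⁻¹ * γ * u := ⟨_, rfl⟩
  obtain ⟨k, hk⟩ : ∃ k, k = (A t)⁻¹ * f * A t := ⟨_, rfl⟩
  have hff : u⁻¹ * γ ^ 2 * u = f * f := by rw [hf, pow_two]; group
  have hkd : dist (vray 0) (k • vray 0) = l := by
    rw [← hl, ← dist_smul (u * A t) (vray 0) (k • vray 0), vray_eq t, smul_smul, smul_smul,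
      smul_smul]
    congr 2
    rw [hk, hf]; group
  have hcosh := two_cosh_dist k
  rw [hkd] at hcosh
  obtain ⟨s, hs⟩ : ∃ s, s = 2 * Real.cosh l - 2 := ⟨_, rfl⟩
  have hs0 : 0 ≤ s := by have := Real.one_le_cosh l; linarith
  rw [← hs, hff]
  have htr : 4 < (k 0 0 + k 1 1) ^ 2 := by
    have h1 : k 0 0 + k 1 1 = γ 0 0 + γ 1 1 := by
      rw [hk, (conj_entries f t).1, (conj_entries f t).2.2.2, hf]
      obtain ⟨i0, i1, i2, i3⟩ := sl_inv u
      simp only [sl_mul, i0, i1, i2, i3]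
      linear_combination (γ 0 0 + γ 1 1) * sl_det u
    rw [IsHyperbolic, Matrix.trace_fin_two] at hh
    rw [h1, ← sq_abs]
    nlinarith
  have hdet := sl_det k
  obtain ⟨c0, c1, c2, c3⟩ := conj_entries f t
  rw [← hk] at c0 c1 c2 c3
  have hE := Real.exp_pos t
  have hEE : Real.exp (-t) * Real.exp t = 1 := by rw [← Real.exp_add]; simp
  obtain ⟨a, ha⟩ : ∃ a, a = k 0 0 := ⟨_, rfl⟩
  obtain ⟨b, hb⟩ : ∃ b, b = k 0 1 := ⟨_, rfl⟩
  obtain ⟨c, hc⟩ : ∃ c, c = k 1 0 := ⟨_, rfl⟩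
  obtain ⟨d, hd'⟩ : ∃ d, d = k 1 1 := ⟨_, rfl⟩
  rw [← ha, ← hb, ← hc, ← hd'] at hcosh
  rw [← ha, ← hd'] at htr
  rw [← ha, ← hb, ← hc, ← hd'] at hdet
  rw [← ha] at c0
  rw [← hb] at c1
  rw [← hc] at c2
  rw [← hd'] at c3
  have hcosh' : a ^ 2 + b ^ 2 + c ^ 2 + d ^ 2 = s + 2 := by linarith
  have f01 : f 0 1 = b * Real.exp t := by rw [c1, mul_assoc, hEE, mul_one]
  have f10 : f 1 0 = c * Real.exp (-t) := by
    rw [c2, mul_assoc, mul_comm (Real.exp t), hEE, mul_one]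
  obtain ⟨hbc, r1, r2, r3, r4⟩ := real_bounds a b c d s hcosh' hdet htr
  have g00 : (f * f) 0 0 - 1 = 2 * (b * c) + (a - d) * a := by
    rw [sl_mul, ← c0, f01, f10]
    linear_combination hdet + b * c * hEE
  have g11 : (f * f) 1 1 - 1 = 2 * (b * c) - (a - d) * d := by
    rw [sl_mul, ← c3, f01, f10]
    linear_combination hdet + b * c * hEE
  have g01 : (f * f) 0 1 = b * (a + d) * Real.exp t := by
    rw [sl_mul, ← c3, ← c0, f01]; ring
  have g10 : (f * f) 1 0 = c * (a + d) * Real.exp (-t) := by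
    rw [sl_mul, ← c3, ← c0, f10]; ring
  refine ⟨⟨?_, ?_, ?_, ?_⟩, ?_⟩
  · rw [g00]; exact (abs_add_le _ _).trans (add_le_add hbc r3)
  · rw [g01, abs_mul, abs_of_pos hE]
    gcongr; linarith
  · rw [g10, abs_mul, abs_of_pos (Real.exp_pos _), mul_assoc, hEE, mul_one]; linarith
  · rw [g11]; exact (abs_sub _ _).trans (add_le_add hbc r4)
  · by_contra hcon
    push Not at hcon
    have hdd := sl_det (f * f)
    rw [hcon.1, hcon.2] at hdd
    rw [hcon.1] at g00
    have : (f * f) 1 1 = 1 := by linarith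
    rw [this] at g11
    have hz : (a + d) ^ 2 = 4 := by linear_combination 4 * hdet - g00 - g11
    linarith

theorem nhds_one {s : Set SL(2, ℝ)} (hs : s ∈ 𝓝 (1 : SL(2, ℝ))) :
    ∃ r > 0, ∀ h : SL(2, ℝ), (∀ i j, |h i j - (1 : SL(2, ℝ)) i j| ≤ r) → h ∈ s := by
  by_contra hcon
  push Not at hcon
  choose h h1 h2 using fun n : ℕ => hcon (1 / (n + 1 : ℝ)) (by positivity)
  have : Tendsto h atTop (𝓝 1) := by
    rw [nhds_induced, tendsto_comap_iff]
    refine tendsto_pi_nhds.2 fun i => tendsto_pi_nhds.2 fun j => ?_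
    rw [tendsto_iff_dist_tendsto_zero]
    refine squeeze_zero (fun _ => dist_nonneg) (fun n => ?_) tendsto_one_div_add_atTop_nhds_zero_nat
    rw [Real.dist_eq]
    exact h1 n i j
  obtain ⟨n, hn⟩ := (this.eventually hs).exists
  exact h2 n hn

theorem d1_small {ε : ℝ} (hε : 0 < ε) :
    ∃ r > 0, ∀ h : SL(2, ℝ), (∀ i j, |h i j - (1 : SL(2, ℝ)) i j| ≤ r) → d1 1 h < ε := by
  have hc : Continuous (fun h : SL(2, ℝ) => d1 1 h) := by
    have h1 : ∀ z : ℍ, Continuous (fun h : SL(2, ℝ) => h • z) := by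
      intro z
      have := @Continuous.smul SL(2, ℝ) ℍ SL(2, ℝ) Matrix.SpecialLinearGroup.instTopologicalSpace _
        Matrix.SpecialLinearGroup.instTopologicalSpace _ UpperHalfPlane.instContinuousSMulSL2R
        (fun h => h) (fun _ => z) (@continuous_id _ Matrix.SpecialLinearGroup.instTopologicalSpace)
        (@continuous_const _ _ Matrix.SpecialLinearGroup.instTopologicalSpace _ z)
      exact this
    unfold d1
    exact (continuous_const.dist (h1 _)).add (continuous_const.dist (h1 _))
  have h0 : d1 1 1 = 0 := by simp [d1]
  apply nhds_one (s := {h | d1 1 h < ε})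
  exact hc.continuousAt.eventually_lt_const (by simpa [h0] using hε)

theorem d1_mul (g h k : SL(2, ℝ)) : d1 (g * h) (g * k) = d1 h k := by
  simp only [d1, mul_smul, dist_smul]

theorem Near.mono {η η' E : ℝ} {g : SL(2, ℝ)} (h : Near η E g) (hE : 0 < E) (hη : η ≤ η') :
    Near η' E g :=
  ⟨h.h00.trans hη, h.h01.trans (by gcongr), h.h10.trans hη, h.h11.trans hη⟩

theorem exists_near (Γ : Subgroup SL(2, ℝ)) (hdisc : DiscreteTopology Γ)
    (u : SL(2, ℝ)) (γ : ℕ → SL(2, ℝ)) (hmem : ∀ n, γ n ∈ Γ)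
    (hhyp : ∀ n, IsHyperbolic (γ n))
    (hmeet : ∀ n, ∃ t : ℝ, 0 ≤ t ∧ (u • vray t : ℍ) ∈ Axis (γ n))
    (hlen : Tendsto (fun n => transLength (γ n)) atTop (nhds 0)) (T δ : ℝ) (hδ : 0 < δ) :
    ∃ E : ℝ, ∃ g : SL(2, ℝ), 0 < E ∧ T ≤ E ∧ u * g * u⁻¹ ∈ Γ ∧ Near δ E g ∧
      (g 0 0 ≠ 1 ∨ g 1 0 ≠ 0) := by
  choose t ht0 ht using hmeet
  obtain ⟨κ, hκ⟩ : ∃ κ : ℕ → ℝ, ∀ n, κ n = 2 * (2 * Real.cosh (transLength (γ n)) - 2) +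
    √(2 * Real.cosh (transLength (γ n)) - 2) * √(2 * Real.cosh (transLength (γ n)) - 2 + 4) :=
    ⟨_, fun _ => rfl⟩
  obtain ⟨g, hg⟩ : ∃ g : ℕ → SL(2, ℝ), ∀ n, g n = u⁻¹ * γ n ^ 2 * u := ⟨_, fun _ => rfl⟩
  have hN : ∀ n, Near (κ n) (Real.exp (t n)) (g n) ∧ (g n 0 0 ≠ 1 ∨ g n 1 0 ≠ 0) := by
    intro n
    rw [hκ, hg]
    exact near_of_dist (γ n) u (t n) _ (hhyp n) (ht n)
  have hκ0 : Tendsto κ atTop (𝓝 0) := by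
    have hc : Continuous (fun l : ℝ => 2 * (2 * Real.cosh l - 2) +
      √(2 * Real.cosh l - 2) * √(2 * Real.cosh l - 2 + 4)) := by fun_prop
    have := (hc.tendsto 0).comp hlen
    simp only [Real.cosh_zero] at this
    norm_num at this
    exact this.congr fun n => (hκ n).symm
  have hback : ∀ n, u * g n * u⁻¹ = γ n ^ 2 := fun n => by rw [hg]; group
  by_contra hcon
  push Not at hcon
  have hev : ∀ᶠ n in atTop, Real.exp (t n) < T := by
    filter_upwards [hκ0.eventually (gt_mem_nhds hδ)] with n hn
    by_contra hT
    push Not at hT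
    rcases (hN n).2 with h | h
    · exact h (hcon _ (g n) (Real.exp_pos _) hT (by rw [hback]; exact pow_mem (hmem n) 2)
        ((hN n).1.mono (Real.exp_pos _) hn.le)).1
    · exact h (hcon _ (g n) (Real.exp_pos _) hT (by rw [hback]; exact pow_mem (hmem n) 2)
        ((hN n).1.mono (Real.exp_pos _) hn.le)).2
  have hlim : Tendsto (fun n => (g n : Matrix (Fin 2) (Fin 2) ℝ)) atTop (𝓝 1) := by
    have key : ∀ i j, Tendsto (fun n => g n i j) atTop (𝓝 ((1 : Matrix (Fin 2) (Fin 2) ℝ) i j)) := by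
      have hz : ∀ (f : ℕ → ℝ) (a : ℝ) (C : ℝ), (∀ᶠ n in atTop, |f n - a| ≤ κ n * C) →
          Tendsto f atTop (𝓝 a) := by
        intro f a C hf
        rw [tendsto_iff_dist_tendsto_zero]
        have h0 : Tendsto (fun n => κ n * C) atTop (𝓝 0) := by simpa using hκ0.mul_const C
        exact squeeze_zero' (.of_forall fun _ => dist_nonneg)
          (hf.mono fun n hn => by rwa [Real.dist_eq]) h0
      intro i j
      fin_cases i <;> fin_cases j
      · refine hz _ _ 1 (.of_forall fun n => ?_)
        simpa using (hN n).1.h00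
      · refine hz _ _ T (hev.mono fun n hn => ?_)
        have h1 := (hN n).1.h01
        have h2 : 0 ≤ κ n := (abs_nonneg _).trans (hN n).1.h00
        have h3 : κ n * Real.exp (t n) ≤ κ n * T := by gcongr
        simpa using h1.trans h3
      · refine hz _ _ 1 (.of_forall fun n => ?_)
        have h1 := (hN n).1.h10
        have h2 : |g n 1 0| * 1 ≤ |g n 1 0| * Real.exp (t n) := by
          gcongr
          exact Real.one_le_exp (ht0 n)
        simpa using h2.trans h1
      · refine hz _ _ 1 (.of_forall fun n => ?_)
        simpa using (hN n).1.h11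
    exact tendsto_pi_nhds.2 fun i => tendsto_pi_nhds.2 fun j => key i j
  have hlim2 : Tendsto (fun n => ((γ n ^ 2 : SL(2, ℝ)) : Matrix (Fin 2) (Fin 2) ℝ))
      atTop (𝓝 1) := by
    have h1 := (hlim.const_mul (u : Matrix (Fin 2) (Fin 2) ℝ)).mul_const
      ((u⁻¹ : SL(2, ℝ)) : Matrix (Fin 2) (Fin 2) ℝ)
    have h2 : (u : Matrix (Fin 2) (Fin 2) ℝ) * 1 * ((u⁻¹ : SL(2, ℝ)) : Matrix (Fin 2) (Fin 2) ℝ)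
        = 1 := by
      rw [mul_one, ← Matrix.SpecialLinearGroup.coe_mul, mul_inv_cancel]; rfl
    rw [h2] at h1
    refine h1.congr fun n => ?_
    rw [← hback n, Matrix.SpecialLinearGroup.coe_mul, Matrix.SpecialLinearGroup.coe_mul]
  have hlim3 : Tendsto (fun n => (⟨γ n ^ 2, pow_mem (hmem n) 2⟩ : Γ)) atTop (𝓝 1) := by
    rw [nhds_induced, tendsto_comap_iff, nhds_induced, tendsto_comap_iff]
    exact hlim2
  rw [nhds_discrete, tendsto_pure] at hlim3
  obtain ⟨n, hn⟩ := hlim3.exists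
  have hn' : γ n ^ 2 = 1 := congrArg Subtype.val hn
  have hg1 : g n = 1 := by rw [hg, hn']; group
  have := (hN n).2
  rw [hg1] at this
  simp at this

theorem exists_chain {S : Type*} (P : S → Prop) (R : S → S → Prop) (h0 : ∃ s, P s)
    (hstep : ∀ s, P s → ∃ s', P s' ∧ R s s') :
    ∃ f : ℕ → S, ∀ n, P (f n) ∧ R (f n) (f (n + 1)) := by
  obtain ⟨s0, hs0⟩ := h0
  choose! nx h1 h2 using hstep
  have hP : ∀ n, P (nx^[n] s0) := by
    intro n
    induction n with
    | zero => exact hs0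
    | succ n ih => rw [Function.iterate_succ_apply']; exact h1 _ ih
  refine ⟨fun n => nx^[n] s0, fun n => ⟨hP n, ?_⟩⟩
  beta_reduce
  rw [Function.iterate_succ_apply']
  exact h2 _ (hP n)

theorem exists_sequence (Q : SL(2, ℝ) → Prop)
    (H : ∀ T δ : ℝ, 0 < δ → ∃ E : ℝ, ∃ g : SL(2, ℝ), 0 < E ∧ T ≤ E ∧ Q g ∧ Near δ E g ∧
      (g 0 0 ≠ 1 ∨ g 1 0 ≠ 0)) :
    ∃ (g : ℕ → SL(2, ℝ)) (η E : ℕ → ℝ), Good g η E ∧ (∀ n, Q (g n)) ∧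
      ∀ n, 13 * η (n + 1) ≤ |g n 0 0 - 1| ∨ 13 * η (n + 1) ≤ |g n 1 0| * E n := by
  obtain ⟨f, hf⟩ := exists_chain (S := ℝ × ℝ × SL(2, ℝ))
    (fun s => 0 < s.1 ∧ s.1 ≤ 1 / 100 ∧ 0 < s.2.1 ∧ Near s.1 s.2.1 s.2.2 ∧ Q s.2.2 ∧
      (s.2.2 0 0 ≠ 1 ∨ s.2.2 1 0 ≠ 0))
    (fun s s' => 4 * s'.1 ≤ s.1 ∧ s.2.1 ≤ s'.1 * s'.2.1 ∧
      (13 * s'.1 ≤ |s.2.2 0 0 - 1| ∨ 13 * s'.1 ≤ |s.2.2 1 0| * s.2.1))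
    (by
      obtain ⟨E, g, h1, -, h2, h3, h4⟩ := H 0 (1 / 100) (by norm_num)
      exact ⟨(1 / 100, E, g), by norm_num, le_rfl, h1, h3, h2, h4⟩)
    (by
      rintro ⟨η, E, g⟩ ⟨h1, h2, h3, h4, h5, h6⟩
      simp only at h1 h2 h3 h4 h5 h6
      have hD : ∃ D > 0, D ≤ |g 0 0 - 1| ∨ D ≤ |g 1 0| * E := by
        rcases h6 with h | h
        · exact ⟨_, abs_pos.2 (sub_ne_zero.2 h), Or.inl le_rfl⟩
        · exact ⟨_, mul_pos (abs_pos.2 h) h3, Or.inr le_rfl⟩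
      obtain ⟨D, hD0, hD⟩ := hD
      obtain ⟨η', hη'⟩ : ∃ η', η' = min (η / 4) (D / 13) := ⟨_, rfl⟩
      have p1 : 0 < η' := by rw [hη']; positivity
      have p2 : η' ≤ η / 4 := by rw [hη']; exact min_le_left _ _
      have p3 : η' ≤ D / 13 := by rw [hη']; exact min_le_right _ _
      obtain ⟨E', g', q1, q2, q3, q4, q5⟩ := H (E / η') η' p1
      refine ⟨(η', E', g'), ⟨p1, by linarith, q1, q4, q3, q5⟩, by simp only; linarith, ?_, ?_⟩
      · rw [div_le_iff₀ p1] at q2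
        simp only; linarith
      · simp only
        rcases hD with h | h
        · left; linarith
        · right; linarith)
  exact ⟨fun n => (f n).2.2, fun n => (f n).1, fun n => (f n).2.1,
    ⟨fun n => (hf n).1.1, fun n => (hf n).1.2.1, fun n => (hf n).2.1, fun n => (hf n).1.2.2.1,
      fun n => (hf n).2.2.1, fun n => (hf n).1.2.2.2.1⟩,
    fun n => (hf n).1.2.2.2.2.1, fun n => (hf n).2.2.2⟩

/-- The subproduct sequence attached to a sequence of bits. -/
def bits (g : ℕ → SL(2, ℝ)) (ε : ℕ → Bool) (n : ℕ) : SL(2, ℝ) := if ε n then g n else 1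

theorem good_bits {g : ℕ → SL(2, ℝ)} {η E : ℕ → ℝ} (h : Good g η E) (ε : ℕ → Bool) :
    Good (bits g ε) η E := by
  refine ⟨h.pos, h.small, h.dec, h.Epos, h.Einc, fun n => ?_⟩
  unfold bits
  split_ifs
  · exact h.near n
  · exact near_one (h.pos n).le (h.Epos n)

theorem sl_cancel (g : SL(2, ℝ)) {x z x' z' : ℝ} (h1 : g 0 0 * x + g 0 1 * z = g 0 0 * x' + g 0 1 * z')
    (h2 : g 1 0 * x + g 1 1 * z = g 1 0 * x' + g 1 1 * z') : x = x' ∧ z = z' := by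
  have hd := sl_det g
  constructor
  · linear_combination g 1 1 * h1 - g 0 1 * h2 - (x - x') * hd
  · linear_combination g 0 0 * h2 - g 1 0 * h1 - (z - z') * hd

theorem tp_mem (Γ : Subgroup SL(2, ℝ)) (u : SL(2, ℝ)) (α : ℕ → SL(2, ℝ))
    (h : ∀ n, u * α n * u⁻¹ ∈ Γ) (N n : ℕ) : u * tp α n N * u⁻¹ ∈ Γ := by
  induction N generalizing n with
  | zero => simp [tp]
  | succ N ih =>
    have := Γ.mul_mem (h n) (ih (n + 1))
    rw [tp]
    convert this using 1
    group

theorem tendsto_stable (Γ : Subgroup SL(2, ℝ)) (u : SL(2, ℝ)) {α : ℕ → SL(2, ℝ)}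
    {η E X Z : ℕ → ℝ} (h : Good α η E) (hmem : ∀ n, u * α n * u⁻¹ ∈ Γ)
    (hXZ : ∀ n, |X n - 1| ≤ 3 * η n ∧ |Z n| * E n ≤ 3 * η n ∧
      X n = α n 0 0 * X (n + 1) + α n 0 1 * Z (n + 1) ∧
      Z n = α n 1 0 * X (n + 1) + α n 1 1 * Z (n + 1)) (w : SL(2, ℝ))
    (h00 : w 0 0 = X 0) (h10 : w 1 0 = Z 0) (h01 : w 0 1 = 0) :
    Tendsto (fun t : ℝ => ⨅ δ : Γ, d1 (u * A t) ((δ : SL(2, ℝ)) * ((u * w) * A t)))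
        atTop (nhds 0) := by
  have hd1 : ∀ g k, 0 ≤ d1 g k := fun g k => add_nonneg dist_nonneg dist_nonneg
  have hη0 : Tendsto η atTop (𝓝 0) := by
    have h1 : Tendsto (fun n => η 0 * (1 / 4 : ℝ) ^ n) atTop (𝓝 0) := by
      simpa using (tendsto_pow_atTop_nhds_zero_of_lt_one (r := (1 / 4 : ℝ)) (by norm_num)
        (by norm_num)).const_mul (η 0)
    exact squeeze_zero (fun n => (h.pos n).le) (fun n => by simpa using h.geom 0 n) h1
  have hmono : Monotone E := monotone_nat_of_le_succ h.Emono
  have hanti : Antitone η := antitone_nat_of_succ_le fun n => by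
    linarith [h.dec n, h.pos (n + 1)]
  have hEtop : Tendsto E atTop atTop := by
    have h1 : ∀ n, E 0 * 2 ^ n ≤ E n := by
      intro n
      induction n with
      | zero => simp
      | succ n ih =>
        have := h.Einc n
        have := h.small (n + 1)
        have := h.Epos (n + 1)
        rw [pow_succ]
        nlinarith
    exact tendsto_atTop_mono h1
      ((tendsto_pow_atTop_atTop_of_one_lt one_lt_two).const_mul_atTop (h.Epos 0))
  rw [Metric.tendsto_atTop]
  intro ε hε
  obtain ⟨r, hr, hsmall⟩ := d1_small hε
  obtain ⟨n0, hn0⟩ := (hη0.eventually (gt_mem_nhds (show (0 : ℝ) < r / 12 by positivity))).exists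
  refine ⟨Real.log (E n0), fun t ht => ?_⟩
  have hT : E n0 ≤ Real.exp t := (Real.log_le_iff_le_exp (h.Epos n0)).1 ht
  obtain ⟨n, hn, hT1, hT2⟩ : ∃ n, n0 ≤ n ∧ E n ≤ Real.exp t ∧ Real.exp t ≤ E (n + 1) := by
    by_contra hcon
    push Not at hcon
    have hall : ∀ k, E (n0 + k) ≤ Real.exp t := by
      intro k
      induction k with
      | zero => exact hT
      | succ k ih => exact (hcon _ (by omega) ih).le
    obtain ⟨m, hm⟩ := (hEtop.eventually (eventually_gt_atTop (Real.exp t))).exists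
    have := hall m
    have := hmono (show m ≤ n0 + m by omega)
    linarith
  have hηr : 12 * η n ≤ r := by linarith [hanti hn]
  obtain ⟨b1, b2, b3, b4⟩ := stable_estimate h hXZ w h00 h10 h01 n (Real.exp t) hT1 hT2
  obtain ⟨β, hβ⟩ : ∃ β, β = tp α 0 (n + 1) := ⟨_, rfl⟩
  have hβm := tp_mem Γ u α hmem (n + 1) 0
  rw [← hβ] at b1 b2 b3 b4 hβm
  have hinv : u * β⁻¹ * u⁻¹ ∈ Γ := by
    have := Γ.inv_mem hβm
    convert this using 1
    group
  have hle : (⨅ δ : Γ, d1 (u * A t) ((δ : SL(2, ℝ)) * ((u * w) * A t))) ≤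
      d1 (u * A t) ((u * β⁻¹ * u⁻¹) * ((u * w) * A t)) :=
    ciInf_le ⟨0, by rintro _ ⟨δ, rfl⟩; exact hd1 _ _⟩ (⟨_, hinv⟩ : Γ)
  have hnn : 0 ≤ (⨅ δ : Γ, d1 (u * A t) ((δ : SL(2, ℝ)) * ((u * w) * A t))) :=
    Real.iInf_nonneg fun δ => hd1 _ _
  rw [Real.dist_eq, sub_zero, abs_of_nonneg hnn]
  refine lt_of_le_of_lt hle ?_
  have e1 : (u * β⁻¹ * u⁻¹) * ((u * w) * A t) =
      (u * A t) * ((A t)⁻¹ * (β⁻¹ * w) * A t) := by group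
  have e2 : u * A t = (u * A t) * 1 := (mul_one _).symm
  rw [e1]
  nth_rewrite 1 [e2]
  rw [d1_mul]
  apply hsmall
  obtain ⟨c0, c1, c2, c3⟩ := conj_entries (β⁻¹ * w) t
  have hE := Real.exp_pos t
  have hEE : Real.exp t * Real.exp (-t) = 1 := by rw [← Real.exp_add]; simp
  intro i j
  fin_cases i <;> fin_cases j
  · change |((A t)⁻¹ * (β⁻¹ * w) * A t) 0 0 - _| ≤ r
    rw [c0]
    simpa using b1.trans hηr
  · change |((A t)⁻¹ * (β⁻¹ * w) * A t) 0 1 - _| ≤ r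
    rw [c1]
    have : |(β⁻¹ * w) 0 1 * Real.exp (-t)| ≤ 12 * η n := by
      rw [abs_mul, abs_of_pos (Real.exp_pos _)]
      calc _ ≤ 12 * η n * Real.exp t * Real.exp (-t) := by gcongr
        _ = _ := by rw [mul_assoc, hEE, mul_one]
    simpa using this.trans hηr
  · change |((A t)⁻¹ * (β⁻¹ * w) * A t) 1 0 - _| ≤ r
    rw [c2]
    have : |(β⁻¹ * w) 1 0 * Real.exp t| ≤ 12 * η n := by
      rw [abs_mul, abs_of_pos (Real.exp_pos _)]
      exact b3
    simpa using this.trans hηr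
  · change |((A t)⁻¹ * (β⁻¹ * w) * A t) 1 1 - _| ≤ r
    rw [c3]
    simpa using b4.trans hηr

theorem countable_of_disc (Γ : Subgroup SL(2, ℝ)) (hdisc : DiscreteTopology Γ) : Countable Γ := by
  have h0 : SecondCountableTopology (Matrix (Fin 2) (Fin 2) ℝ) :=
    inferInstanceAs (SecondCountableTopology (Fin 2 → Fin 2 → ℝ))
  have h1 : SecondCountableTopology SL(2, ℝ) :=
    TopologicalSpace.secondCountableTopology_induced SL(2, ℝ) (Matrix (Fin 2) (Fin 2) ℝ) _
  have h2 : SecondCountableTopology Γ :=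
    TopologicalSpace.secondCountableTopology_induced Γ SL(2, ℝ) Subtype.val
  exact countable_of_Lindelof_of_discrete

theorem not_countable_bits : ¬ Countable (ℕ → Bool) := by
  intro h
  obtain ⟨f, hf⟩ := exists_surjective_nat (ℕ → Bool)
  obtain ⟨n, hn⟩ := hf (fun n => !(f n n))
  have := congrFun hn n
  simp at this

theorem bits_injective {g : ℕ → SL(2, ℝ)} {η E : ℕ → ℝ} (h : Good g η E)
    (hD : ∀ n, 13 * η (n + 1) ≤ |g n 0 0 - 1| ∨ 13 * η (n + 1) ≤ |g n 1 0| * E n)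
    (X Z : (ℕ → Bool) → ℕ → ℝ)
    (hXZ : ∀ ε n, |X ε n - 1| ≤ 3 * η n ∧ |Z ε n| * E n ≤ 3 * η n ∧
      X ε n = bits g ε n 0 0 * X ε (n + 1) + bits g ε n 0 1 * Z ε (n + 1) ∧
      Z ε n = bits g ε n 1 0 * X ε (n + 1) + bits g ε n 1 1 * Z ε (n + 1))
    (ε ε' : ℕ → Bool) (hX : X ε 0 = X ε' 0) (hZ : Z ε 0 = Z ε' 0) : ε = ε' := by
  have hno : ∀ n (ε ε' : ℕ → Bool), X ε n = X ε' n → Z ε n = Z ε' n → ε n = true →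
      ε' n = false → False := by
    intro n ε ε' e1 e2 h1 h2
    obtain ⟨-, -, a1, a2⟩ := hXZ ε n
    obtain ⟨-, -, b1, b2⟩ := hXZ ε' n
    obtain ⟨c1, c2, -, -⟩ := hXZ ε (n + 1)
    obtain ⟨d1, d2, -, -⟩ := hXZ ε' (n + 1)
    have f1 : bits g ε n = g n := by simp [bits, h1]
    have f2 : bits g ε' n = 1 := by simp [bits, h2]
    rw [f1] at a1 a2
    rw [f2] at b1 b2
    simp at b1 b2
    exact separation (h.near n) (h.pos n) (h.small n) (h.Epos n) (h.Emono n) (h.pos (n + 1))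
      (hD n) c1 c2 d1 d2 (by rw [← a1, e1, b1]) (by rw [← a2, e2, b2])
  have hind : ∀ n, X ε n = X ε' n ∧ Z ε n = Z ε' n := by
    intro n
    induction n with
    | zero => exact ⟨hX, hZ⟩
    | succ n ih =>
      have hb : ε n = ε' n := by
        cases h1 : ε n <;> cases h2 : ε' n
        · rfl
        · exact (hno n ε' ε ih.1.symm ih.2.symm h2 h1).elim
        · exact (hno n ε ε' ih.1 ih.2 h1 h2).elim
        · rfl
      obtain ⟨-, -, a1, a2⟩ := hXZ ε n
      obtain ⟨-, -, b1, b2⟩ := hXZ ε' n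
      have hbb : bits g ε n = bits g ε' n := by simp [bits, hb]
      rw [← hbb] at b1 b2
      exact sl_cancel (bits g ε n) (by rw [← a1, ← b1, ih.1]) (by rw [← a2, ← b2, ih.2])
  funext n
  cases h1 : ε n <;> cases h2 : ε' n
  · rfl
  · exact (hno n ε' ε (hind n).1.symm (hind n).2.symm h2 h1).elim
  · exact (hno n ε ε' (hind n).1 (hind n).2 h1 h2).elim
  · rfl

/-- lower triangular matrix with prescribed first column -/
theorem exists_matrix {x z : ℝ} (hx : x ≠ 0) :
    ∃ w : SL(2, ℝ), w 0 0 = x ∧ w 1 0 = z ∧ w 0 1 = 0 :=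
  ⟨⟨!![x, 0; z, x⁻¹], by simp [Matrix.det_fin_two_of, hx]⟩, by simp, by simp, by simp⟩

theorem strong_stable_strictly_contains_horocycle
    (Γ : Subgroup SL(2, ℝ)) (hdisc : DiscreteTopology Γ)
    (htf : ∀ γ ∈ Γ, ∀ n : ℕ, 0 < n → γ ^ n = 1 → γ = 1)
    (hneg : (-1 : SL(2, ℝ)) ∉ Γ)
    (u : SL(2, ℝ)) (γ : ℕ → SL(2, ℝ)) (hmem : ∀ n, γ n ∈ Γ)
    (hhyp : ∀ n, IsHyperbolic (γ n))
    (hmeet : ∀ n, ∃ t : ℝ, 0 ≤ t ∧ (u • vray t : ℍ) ∈ Axis (γ n))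
    (hlen : Tendsto (fun n => transLength (γ n)) atTop (nhds 0)) :
    ∃ w : SL(2, ℝ),
      Tendsto (fun t : ℝ => ⨅ δ : Γ, d1 (u * A t) ((δ : SL(2, ℝ)) * (w * A t)))
        atTop (nhds 0) ∧
      ∀ δ ∈ Γ, ∀ s : ℝ, ∀ ε : SL(2, ℝ), (ε = 1 ∨ ε = -1) →
        w ≠ ε * (δ * u * N s) := by
  obtain ⟨g, η, E, hgood, hgmem, hD⟩ := exists_sequence (fun g => u * g * u⁻¹ ∈ Γ)
    (fun T δ hδ => exists_near Γ hdisc u γ hmem hhyp hmeet hlen T δ hδ)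
  choose X Z hXZ using fun ε => exists_limit (good_bits hgood ε)
  have hX0 : ∀ ε, X ε 0 ≠ 0 := by
    intro ε h0
    have h1 := (hXZ ε 0).1
    have h2 := hgood.small 0
    rw [h0] at h1
    norm_num at h1
    linarith
  choose w hw00 hw10 hw01 using fun ε => exists_matrix (z := Z ε 0) (hX0 ε)
  have hbm : ∀ ε n, u * bits g ε n * u⁻¹ ∈ Γ := by
    intro ε n
    unfold bits
    split_ifs
    · exact hgmem n
    · simp
  by_contra hcon
  push Not at hcon
  have hall : ∀ ε : ℕ → Bool, ∃ p : Γ × Bool, ∃ s : ℝ,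
      u * w ε = (if p.2 then 1 else -1) * ((p.1 : SL(2, ℝ)) * u * N s) := by
    intro ε
    obtain ⟨δ, hδ, s, σ, hσ, he⟩ := hcon (u * w ε)
      (tendsto_stable Γ u (good_bits hgood ε) (hbm ε) (hXZ ε) (w ε) (hw00 ε) (hw10 ε) (hw01 ε))
    rcases hσ with rfl | rfl
    · exact ⟨(⟨δ, hδ⟩, true), s, by simpa using he⟩
    · exact ⟨(⟨δ, hδ⟩, false), s, by simpa using he⟩
  choose p s hp using hall
  have hinj : Function.Injective p := by
    intro ε ε' hpp
    have key : ∀ ε, ∃ V : SL(2, ℝ), V = u⁻¹ * ((if (p ε).2 then 1 else -1) * ((p ε).1 * u)) ∧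
        X ε 0 = V 0 0 ∧ Z ε 0 = V 1 0 := by
      intro ε
      refine ⟨_, rfl, ?_⟩
      obtain ⟨V, hV⟩ : ∃ V : SL(2, ℝ),
        V = u⁻¹ * ((if (p ε).2 then 1 else -1) * ((p ε).1 * u)) := ⟨_, rfl⟩
      rw [← hV]
      have : w ε = V * N (s ε) := by
        have := congrArg (fun x => u⁻¹ * x) (hp ε)
        simp only [inv_mul_cancel_left] at this
        rw [this, hV]
        simp only [mul_assoc]
      rw [← hw00, ← hw10, this, sl_mul, sl_mul]
      simp [N]
    obtain ⟨V, hV, v1, v2⟩ := key ε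
    obtain ⟨V', hV', v1', v2'⟩ := key ε'
    have hVV : V = V' := by rw [hV, hV', hpp]
    exact bits_injective hgood hD X Z hXZ ε ε' (by rw [v1, v1', hVV]) (by rw [v2, v2', hVV])
  have := countable_of_disc Γ hdisc
  exact not_countable_bits hinj.countable

end BellisFormal
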